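/- Let n ≥ 2 be even and define f: S^{n-1} → ℝ by f(x) = √((n+2)/2) · [Σ_{i=1}^{n/2} x_i² − Σ_{j=n/2+1}^{n} x_j²] (which satisfies ∫_{S^{n-1}} f² dσ = 1). Then d_TV(f(X), Z) ≤ √(6/n). -/

import Mathlib

open MeasureTheory ProbabilityTheory Real Finset

noncomputable section

/-- total variation distance between two (Borel) measures on ℝ -/
def dTV (μ ν : MeasureTheory.Measure ℝ) : ℝ :=
  ⨆ s : {s : Set ℝ // MeasurableSet s}, |(μ s.1).toReal - (ν s.1).toReal|

/-- uniform probability measure on the unit sphere of a Euclidean space -/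
def sphereUniform (ι : Type*) [Fintype ι] :
    MeasureTheory.Measure (Metric.sphere (0 : EuclideanSpace ℝ ι) 1) :=
  ((volume : MeasureTheory.Measure (EuclideanSpace ℝ ι)).toSphere Set.univ)⁻¹ •
    (volume : MeasureTheory.Measure (EuclideanSpace ℝ ι)).toSphere

theorem lintegral_fun_norm_addHaar {E : Type*} [NormedAddCommGroup E] [NormedSpace ℝ E]
    [FiniteDimensional ℝ E] [Nontrivial E] [MeasurableSpace E] [BorelSpace E]
    (μ : Measure E) [μ.IsAddHaarMeasure] {G : ℝ → ENNReal} (hG : Measurable G) :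
    ∫⁻ x, G ‖x‖ ∂μ = μ.toSphere Set.univ *
      ∫⁻ r in Set.Ioi (0 : ℝ), ENNReal.ofReal (r ^ (Module.finrank ℝ E - 1)) * G r := by
  calc
    ∫⁻ x, G ‖x‖ ∂μ = ∫⁻ x : ({(0)}ᶜ : Set E), G ‖x.1‖ ∂(μ.comap (↑)) := by
      rw [lintegral_subtype_comap (measurableSet_singleton _).compl fun x ↦ G ‖x‖,
        restrict_compl_singleton]
    _ = ∫⁻ x, G x.2 ∂μ.toSphere.prod (.volumeIoiPow (Module.finrank ℝ E - 1)) := by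
      simpa using μ.measurePreserving_homeomorphUnitSphereProd.lintegral_comp_emb
        (Homeomorph.measurableEmbedding _) (G ∘ Subtype.val ∘ Prod.snd)
    _ = μ.toSphere Set.univ *
        ∫⁻ r : Set.Ioi (0 : ℝ), G r ∂.volumeIoiPow (Module.finrank ℝ E - 1) := by
      have h := lintegral_prod_mul (μ := μ.toSphere)
        (ν := Measure.volumeIoiPow (Module.finrank ℝ E - 1)) (f := fun _ => 1)
        (g := fun r => G r) (by fun_prop) (by fun_prop)
      simpa using h
    _ = _ := by
      rw [Measure.volumeIoiPow, lintegral_withDensity_eq_lintegral_mul _ (by fun_prop)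
        (by fun_prop)]
      rw [← lintegral_subtype_comap measurableSet_Ioi
        fun r ↦ ENNReal.ofReal (r ^ (Module.finrank ℝ E - 1)) * G r]
      rfl

theorem lintegral_prod_fun_norm_addHaar {E F : Type*} [NormedAddCommGroup E] [NormedSpace ℝ E]
    [FiniteDimensional ℝ E] [Nontrivial E] [MeasurableSpace E] [BorelSpace E]
    [NormedAddCommGroup F] [NormedSpace ℝ F]
    [FiniteDimensional ℝ F] [Nontrivial F] [MeasurableSpace F] [BorelSpace F]
    (μ : Measure E) [μ.IsAddHaarMeasure] (ν : Measure F) [ν.IsAddHaarMeasure]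
    {G : ℝ → ℝ → ENNReal} (hG : Measurable (Function.uncurry G)) :
    ∫⁻ x, G ‖x.1‖ ‖x.2‖ ∂(μ.prod ν) = μ.toSphere Set.univ * ν.toSphere Set.univ *
      ∫⁻ r in Set.Ioi (0 : ℝ), ∫⁻ s in Set.Ioi (0 : ℝ),
        ENNReal.ofReal (r ^ (Module.finrank ℝ E - 1)) *
          (ENNReal.ofReal (s ^ (Module.finrank ℝ F - 1)) * G r s) := by
  have hGr (r : ℝ) : Measurable (G r) := hG.comp measurable_prodMk_left
  rw [lintegral_prod (fun x : E × F => G ‖x.1‖ ‖x.2‖)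
    (hG.comp (by fun_prop : Measurable fun x : E × F => (‖x.1‖, ‖x.2‖))).aemeasurable]
  have h1 (x : E) : ∫⁻ y, G ‖x‖ ‖y‖ ∂ν = ν.toSphere Set.univ *
      ∫⁻ s in Set.Ioi (0 : ℝ), ENNReal.ofReal (s ^ (Module.finrank ℝ F - 1)) * G ‖x‖ s :=
    lintegral_fun_norm_addHaar ν (hGr _)
  have hm : Measurable fun p : ℝ × ℝ =>
      ENNReal.ofReal (p.2 ^ (Module.finrank ℝ F - 1)) * G p.1 p.2 :=
    Measurable.mul (by fun_prop) hG
  simp_rw [h1]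
  have hI : Measurable fun r => ∫⁻ s in Set.Ioi (0 : ℝ),
      ENNReal.ofReal (s ^ (Module.finrank ℝ F - 1)) * G r s := hm.lintegral_prod_right'
  have hI' : Measurable fun x : E => ∫⁻ s in Set.Ioi (0 : ℝ),
      ENNReal.ofReal (s ^ (Module.finrank ℝ F - 1)) * G ‖x‖ s := hI.comp measurable_norm
  rw [lintegral_const_mul _ hI', lintegral_fun_norm_addHaar μ hI,
    ← mul_assoc, mul_comm (ν.toSphere Set.univ)]
  congr 1
  refine lintegral_congr fun r => ?_
  rw [lintegral_const_mul' _ _ ENNReal.ofReal_ne_top]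

theorem lintegral_quadrant_polar (k : ℕ) {H : ℝ → ENNReal} (hH : Measurable H) :
    ∫⁻ r in Set.Ioi (0 : ℝ), ∫⁻ s in Set.Ioi (0 : ℝ),
        ENNReal.ofReal (r ^ k) * (ENNReal.ofReal (s ^ k) *
          (if r ^ 2 + s ^ 2 < 1 then H ((r ^ 2 - s ^ 2) / (r ^ 2 + s ^ 2)) else 0)) =
      (∫⁻ ρ in Set.Ioo (0 : ℝ) 1, ENNReal.ofReal (ρ ^ (2 * k + 1) / 2 ^ k)) *
        ∫⁻ θ in Set.Ioo 0 (π / 2), ENNReal.ofReal (sin (2 * θ) ^ k) * H (cos (2 * θ)) := by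
  set F : ℝ × ℝ → ENNReal := fun p => ENNReal.ofReal (p.1 ^ k) * (ENNReal.ofReal (p.2 ^ k) *
          (if p.1 ^ 2 + p.2 ^ 2 < 1 then H ((p.1 ^ 2 - p.2 ^ 2) / (p.1 ^ 2 + p.2 ^ 2)) else 0))
    with hF
  have hFm : Measurable F := by
    refine Measurable.mul (by fun_prop) (Measurable.mul (by fun_prop) (Measurable.ite ?_ ?_ ?_))
    · exact measurableSet_lt (by fun_prop) (by fun_prop)
    · exact hH.comp (by fun_prop)
    · fun_prop
  have hQ : MeasurableSet (Set.Ioi (0 : ℝ) ×ˢ Set.Ioi (0 : ℝ)) :=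
    measurableSet_Ioi.prod measurableSet_Ioi
  have hpt : ∀ p ∈ Set.Ioi (0 : ℝ) ×ˢ Set.Ioo (-π) π,
      ENNReal.ofReal p.1 • (Set.Ioi (0 : ℝ) ×ˢ Set.Ioi (0 : ℝ)).indicator F (polarCoord.symm p) =
      (Set.Ioo (0 : ℝ) 1).indicator (fun ρ => ENNReal.ofReal (ρ ^ (2 * k + 1) / 2 ^ k)) p.1 *
      (Set.Ioo 0 (π / 2)).indicator
        (fun θ => ENNReal.ofReal (sin (2 * θ) ^ k) * H (cos (2 * θ))) p.2 := by
    rintro ⟨ρ, θ⟩ ⟨hρ, hθ⟩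
    simp only [Set.mem_Ioi, Set.mem_Ioo] at hρ hθ
    by_cases h : θ ∈ Set.Ioo 0 (π / 2)
    · have hs : 0 < sin θ := sin_pos_of_pos_of_lt_pi h.1 hθ.2
      have hc : 0 < cos θ := cos_pos_of_mem_Ioo ⟨by linarith [h.1, pi_pos], h.2⟩
      have hsum : (ρ * cos θ) ^ 2 + (ρ * sin θ) ^ 2 = ρ ^ 2 := by
        linear_combination ρ ^ 2 * sin_sq_add_cos_sq θ
      rw [Set.indicator_of_mem (by simp [polarCoord, hs, hc, hρ]), Set.indicator_of_mem h]
      simp only [hF, polarCoord_symm_apply, hsum]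
      by_cases h1 : ρ < 1
      · rw [Set.indicator_of_mem (by simp [h1, hρ]), if_pos (by nlinarith)]
        have hdiff : ((ρ * cos θ) ^ 2 - (ρ * sin θ) ^ 2) / ρ ^ 2 = cos (2 * θ) := by
          rw [cos_two_mul']
          field_simp
        rw [hdiff, smul_eq_mul, ← mul_assoc, ← mul_assoc, ← mul_assoc,
          ← ENNReal.ofReal_mul hρ.le, ← ENNReal.ofReal_mul (by positivity),
          ← ENNReal.ofReal_mul (by positivity)]
        congr 2
        rw [sin_two_mul]
        field_simp
        ring
      · rw [Set.indicator_of_notMem (by simp [h1]), if_neg (by nlinarith)]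
        simp
    · rw [Set.indicator_of_notMem h, Set.indicator_of_notMem]
      · simp
      · simp only [polarCoord_symm_apply, Set.mem_prod, Set.mem_Ioi, mul_pos_iff_of_pos_left hρ]
        rintro ⟨hc, hs⟩
        refine h ⟨?_, ?_⟩
        · by_contra! h0
          exact absurd hs (sin_nonpos_of_nonpos_of_neg_pi_le h0 hθ.1.le).not_gt
        · by_contra! h0
          exact absurd hc (cos_nonpos_of_pi_div_two_le_of_le h0 (by linarith [hθ.2, pi_pos])).not_gt
  calc
    _ = ∫⁻ p in Set.Ioi (0 : ℝ) ×ˢ Set.Ioi (0 : ℝ), F p := by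
      rw [Measure.volume_eq_prod, ← Measure.prod_restrict, lintegral_prod _ hFm.aemeasurable]
    _ = ∫⁻ p in Set.Ioi (0 : ℝ) ×ˢ Set.Ioo (-π) π, ENNReal.ofReal p.1 •
        (Set.Ioi (0 : ℝ) ×ˢ Set.Ioi (0 : ℝ)).indicator F (polarCoord.symm p) := by
      rw [← lintegral_indicator hQ]
      exact (lintegral_comp_polarCoord_symm _).symm
    _ = _ := by
      rw [setLIntegral_congr_fun (measurableSet_Ioi.prod measurableSet_Ioo) hpt,
        Measure.volume_eq_prod, ← Measure.prod_restrict, lintegral_prod_mul,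
        lintegral_indicator measurableSet_Ioo, lintegral_indicator measurableSet_Ioo,
        Measure.restrict_restrict measurableSet_Ioo, Measure.restrict_restrict measurableSet_Ioo,
        Set.inter_eq_left.2 Set.Ioo_subset_Ioi_self,
        Set.inter_eq_left.2 (Set.Ioo_subset_Ioo (by linarith [pi_pos]) (by linarith [pi_pos]))]
      · exact (Measurable.indicator (by fun_prop) measurableSet_Ioo).aemeasurable
      · refine (Measurable.indicator ?_ measurableSet_Ioo).aemeasurable
        exact Measurable.mul (by fun_prop) (hH.comp (by fun_prop))

theorem dTV_le_of_le_mul {μ ν : Measure ℝ} [IsProbabilityMeasure μ] [IsProbabilityMeasure ν]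
    {ε : ℝ} (hε : 0 ≤ ε)
    (h : ∀ s, MeasurableSet s → μ s ≤ ENNReal.ofReal (1 + ε) * ν s) : dTV μ ν ≤ ε := by
  have key : ∀ s, MeasurableSet s → μ.real s - ν.real s ≤ ε := by
    intro s hs
    have h1 := ENNReal.toReal_mono (by finiteness) (h s hs)
    rw [ENNReal.toReal_mul, ENNReal.toReal_ofReal (by positivity)] at h1
    change μ.real s ≤ (1 + ε) * ν.real s at h1
    nlinarith [measureReal_le_one (μ := ν) (s := s)]
  have : Nonempty {s : Set ℝ // MeasurableSet s} := ⟨⟨∅, .empty⟩⟩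
  refine ciSup_le fun ⟨s, hs⟩ => abs_sub_le_iff.2 ⟨key s hs, ?_⟩
  have h2 := key sᶜ hs.compl
  rw [probReal_compl_eq_one_sub hs, probReal_compl_eq_one_sub hs] at h2
  change ν.real s - μ.real s ≤ ε
  linarith

theorem dTV_le_one (μ ν : Measure ℝ) [IsProbabilityMeasure μ] [IsProbabilityMeasure ν] :
    dTV μ ν ≤ 1 := by
  have : Nonempty {s : Set ℝ // MeasurableSet s} := ⟨⟨∅, .empty⟩⟩
  refine ciSup_le fun ⟨s, hs⟩ => ?_
  change |μ.real s - ν.real s| ≤ 1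
  rw [abs_sub_le_iff]
  constructor <;>
  linarith [measureReal_nonneg (μ := μ) (s := s), measureReal_nonneg (μ := ν) (s := s),
    measureReal_le_one (μ := μ) (s := s), measureReal_le_one (μ := ν) (s := s)]

theorem integral_sin_pow_mul_integral_sin_pow_succ (k : ℕ) :
    (∫ x in 0..π, sin x ^ k) * (∫ x in 0..π, sin x ^ (k + 1)) = 2 * π / (k + 1) := by
  induction k with
  | zero => norm_num [mul_comm]
  | succ k ih =>
    rw [integral_sin_pow (n := k)]
    simp only [sin_zero, sin_pi, ne_eq, Nat.add_eq_zero_iff, one_ne_zero, and_false,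
      not_false_eq_true, zero_pow, zero_mul, sub_zero, zero_div, zero_add]
    rw [mul_left_comm, mul_comm (∫ x in 0..π, sin x ^ (k + 1)), ih]
    push_cast
    field_simp
    ring

theorem two_pi_div_le_integral_sin_pow_sq (k : ℕ) :
    2 * π / (k + 1) ≤ (∫ x in 0..π, sin x ^ k) ^ 2 := by
  rw [← integral_sin_pow_mul_integral_sin_pow_succ, sq]
  exact mul_le_mul_of_nonneg_left (integral_sin_pow_succ_le k) (integral_sin_pow_pos k).le

theorem lintegral_sin_two_mul_pow (k : ℕ) :
    ∫⁻ θ in Set.Ioo 0 (π / 2), ENNReal.ofReal (sin (2 * θ) ^ k) =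
      ENNReal.ofReal ((∫ x in 0..π, sin x ^ k) / 2) := by
  have hpi : (0 : ℝ) ≤ π / 2 := by positivity
  rw [← ofReal_integral_eq_lintegral_ofReal, ← integral_Ioc_eq_integral_Ioo,
    ← intervalIntegral.integral_of_le hpi,
    intervalIntegral.integral_comp_mul_left (fun x => sin x ^ k) two_ne_zero]
  · congr 1
    rw [mul_zero, mul_div_cancel₀ _ two_ne_zero, smul_eq_mul]
    ring
  · exact ((by fun_prop : Continuous fun θ => sin (2 * θ) ^ k).integrableOn_Icc).mono_set
      Set.Ioo_subset_Icc_self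
  · refine (ae_restrict_iff' measurableSet_Ioo).2 (.of_forall fun θ hθ => ?_)
    exact pow_nonneg (sin_nonneg_of_nonneg_of_le_pi (by linarith [hθ.1]) (by linarith [hθ.2])) _

theorem two_mul_le_log_div {x : ℝ} (h₀ : 0 ≤ x) (h : x < 1) :
    2 * x ≤ log ((1 + x) / (1 - x)) := by
  have := sum_range_le_log_div h₀ h 1
  norm_num at this
  linarith

theorem exp_two_mul_le_div {x : ℝ} (h₀ : 0 ≤ x) (h : x < 1) :
    exp (2 * x) ≤ (1 + x) / (1 - x) := by
  rw [← le_log_iff_exp_le (div_pos (by linarith) (by linarith))]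
  exact two_mul_le_log_div h₀ h

theorem pow_le_exp_mul_exp {m : ℕ} (hm : 3 ≤ m) {s c : ℝ} (hs : 0 < s) (hsc : s ^ 2 + c ^ 2 = 1) :
    s ^ (m - 2) ≤ exp (9 / (4 * m - 2)) * exp (-((m + 1) * c ^ 2) / 2) := by
  obtain ⟨k, rfl⟩ : ∃ k, m = k + 3 := ⟨m - 3, by omega⟩
  rw [← exp_log (pow_pos hs _), ← exp_add, exp_le_exp, log_pow]
  have hk : (0 : ℝ) ≤ k := k.cast_nonneg
  push_cast [show k + 3 - 2 = k + 1 by omega]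
  -- the quotient `(m + 1) / (m - 2)` is the reciprocal of the maximiser of the density ratio
  have h1 : log (s ^ 2 * ((k + 4) / (k + 1))) ≤ s ^ 2 * ((k + 4) / (k + 1)) - 1 :=
    log_le_sub_one_of_pos (by positivity)
  rw [log_mul (by positivity) (by positivity), log_pow] at h1
  have hx0 : (0 : ℝ) ≤ 3 / (2 * k + 5) := by positivity
  have hx1 : 3 / (2 * k + 5) < (1 : ℝ) := by rw [div_lt_one (by positivity)]; linarith
  have h2 : 2 * (3 / (2 * k + 5)) ≤ log ((k + 4) / (k + 1) : ℝ) := by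
    convert two_mul_le_log_div hx0 hx1 using 2
    rw [div_eq_div_iff (by positivity) (by linarith)]
    field_simp
    ring
  push_cast at h1
  have h4 : log s ≤ (s ^ 2 * ((k + 4) / (k + 1)) - 1) / 2 - 3 / (2 * k + 5) := by linarith
  calc (k + 1) * log s ≤ (k + 1) * ((s ^ 2 * ((k + 4) / (k + 1)) - 1) / 2 - 3 / (2 * k + 5)) := by
        gcongr
    _ = _ := by
      rw [show c ^ 2 = 1 - s ^ 2 by linarith,
        show (4 * (k + 3) - 2 : ℝ) = 2 * (2 * k + 5) by ring]
      field_simp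
      ring

theorem sqrt_div_mul_exp_le {m : ℕ} (hm : 4 ≤ m) :
    √(m / (m + 1)) * exp (9 / (4 * m - 2)) ≤ 1 + √(3 / m) := by
  have hm' : (4 : ℝ) ≤ m := by exact_mod_cast hm
  have hexp : exp (9 / (4 * m - 2)) ≤ (8 * m + 5) / (8 * m - 13) := by
    have h1 : 9 / (8 * m - 4) < (1 : ℝ) := by rw [div_lt_one (by linarith)]; linarith
    convert exp_two_mul_le_div (div_nonneg (by norm_num) (by linarith)) h1 using 1
    · congr 1
      rw [show (8 * m - 4 : ℝ) = 2 * (4 * m - 2) by ring]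
      field_simp
    · have h2 : (8 * m - 4 : ℝ) ≠ 0 := by linarith
      rw [div_eq_div_iff (by linarith) (by linarith)]
      field_simp
      ring
  refine (mul_le_mul_of_nonneg_left hexp (sqrt_nonneg _)).trans ?_
  rcases hm.eq_or_lt with rfl | hm5
  · have h1 : √((4 : ℕ) / ((4 : ℕ) + 1)) ≤ 9 / 10 := sqrt_le_iff.2 (by norm_num)
    have h2 : 86 / 100 ≤ √(3 / (4 : ℕ)) := le_sqrt_of_sq_le (by norm_num)
    norm_num at h1 h2 ⊢
    linarith
  · have hm5' : (5 : ℝ) ≤ m := by exact_mod_cast hm5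
    have h1 : √(m / (m + 1) : ℝ) ≤ 1 :=
      sqrt_le_one.2 (by rw [div_le_one (by positivity)]; linarith)
    have h2 : 18 / (8 * m - 13) ≤ √(3 / m : ℝ) := by
      refine le_sqrt_of_sq_le ?_
      rw [div_pow, div_le_div_iff₀ (by nlinarith) (by positivity)]
      nlinarith
    have h3 : (8 * m + 5) / (8 * m - 13) = 1 + 18 / (8 * m - 13 : ℝ) := by
      have : (8 * m - 13 : ℝ) ≠ 0 := by linarith
      field_simp
      ring
    rw [h3]
    have h4 : (0 : ℝ) ≤ 18 / (8 * m - 13) := div_nonneg (by norm_num) (by linarith)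
    nlinarith

theorem sin_pow_le_gaussianPDFReal {m : ℕ} (hm : 4 ≤ m) {φ : ℝ} (hφ : 0 < sin φ) :
    sin φ ^ (m - 1) ≤ (1 + √(3 / m)) * ((∫ x in 0..π, sin x ^ (m - 1)) / 2) *
      (√(m + 1) * (2 * sin φ) * gaussianPDFReal 0 1 (√(m + 1) * cos φ)) := by
  set S := ∫ x in 0..π, sin x ^ (m - 1)
  have hm0 : (0 : ℝ) < m := by positivity
  have hS : √(2 * π / m) ≤ S := by
    refine (sqrt_le_left (integral_sin_pow_pos _).le).2 ?_
    have h := two_pi_div_le_integral_sin_pow_sq (m - 1)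
    rwa [Nat.cast_sub (by omega), Nat.cast_one, sub_add_cancel] at h
  have h1 := pow_le_exp_mul_exp (by omega : 3 ≤ m) hφ (sin_sq_add_cos_sq φ)
  have hone : 1 = √(m / (m + 1) : ℝ) * √(2 * π / m) * √(m + 1) / √(2 * π) := by
    rw [← sqrt_mul (by positivity), ← sqrt_mul (by positivity), ← sqrt_div (by positivity)]
    symm
    rw [sqrt_eq_one]
    field_simp
  calc sin φ ^ (m - 1) = sin φ ^ (m - 2) * sin φ := by
        rw [← pow_succ, show m - 2 + 1 = m - 1 by omega]
    _ ≤ exp (9 / (4 * m - 2)) * exp (-((m + 1) * cos φ ^ 2) / 2) * sin φ := by gcongr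
    _ = √(m / (m + 1) : ℝ) * exp (9 / (4 * m - 2)) * √(2 * π / m) *
        (√(m + 1) * sin φ * ((√(2 * π))⁻¹ * exp (-((m + 1) * cos φ ^ 2) / 2))) := by
      linear_combination
        (exp (9 / (4 * m - 2)) * exp (-((m + 1) * cos φ ^ 2) / 2) * sin φ) * hone
    _ ≤ (1 + √(3 / m)) * S *
        (√(m + 1) * sin φ * ((√(2 * π))⁻¹ * exp (-((m + 1) * cos φ ^ 2) / 2))) := by
      gcongr
      exact sqrt_div_mul_exp_le hm
    _ = _ := by
      have h2 : (√(m + 1) * cos φ - 0) ^ 2 = (m + 1) * cos φ ^ 2 := by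
        rw [sub_zero, mul_pow, sq_sqrt (by positivity)]
      simp only [gaussianPDFReal, h2, NNReal.coe_one, mul_one]
      ring

theorem setLIntegral_sin_pow_le_gaussianReal {m : ℕ} (hm : 4 ≤ m) {A : Set ℝ}
    (hA : MeasurableSet A) :
    ∫⁻ θ in Set.Ioo 0 (π / 2), ENNReal.ofReal (sin (2 * θ) ^ (m - 1)) *
        A.indicator 1 (√(m + 1) * cos (2 * θ)) ≤
      ENNReal.ofReal (1 + √(3 / m)) * gaussianReal 0 1 A *
        ∫⁻ θ in Set.Ioo 0 (π / 2), ENNReal.ofReal (sin (2 * θ) ^ (m - 1)) := by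
  have hinj : Set.InjOn (fun θ => √(m + 1) * cos (2 * θ)) (Set.Ioo 0 (π / 2)) := by
    intro x hx y hy hxy
    have h := injOn_cos (x₁ := 2 * x) ⟨by linarith [hx.1], by linarith [hx.2]⟩
      (x₂ := 2 * y) ⟨by linarith [hy.1], by linarith [hy.2]⟩
      (mul_left_cancel₀ (by positivity : √(m + 1 : ℝ) ≠ 0) hxy)
    linarith
  have hderiv : ∀ θ ∈ Set.Ioo 0 (π / 2), HasDerivWithinAt (fun θ => √(m + 1) * cos (2 * θ))
      (√(m + 1) * (-sin (2 * θ) * (2 * 1))) (Set.Ioo 0 (π / 2)) θ := fun θ _ =>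
    ((((hasDerivAt_id θ).const_mul 2).cos).const_mul _).hasDerivWithinAt
  rw [lintegral_sin_two_mul_pow, mul_right_comm,
    ← ENNReal.ofReal_mul (by positivity), gaussianReal_apply _ one_ne_zero,
    ← lintegral_indicator hA]
  calc _ ≤ ∫⁻ θ in Set.Ioo 0 (π / 2),
        ENNReal.ofReal ((1 + √(3 / m)) * ((∫ x in 0..π, sin x ^ (m - 1)) / 2)) *
        (ENNReal.ofReal |√(m + 1) * (-sin (2 * θ) * (2 * 1))| *
          A.indicator (gaussianPDF 0 1) (√(m + 1) * cos (2 * θ))) := by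
        refine setLIntegral_mono' measurableSet_Ioo fun θ hθ => ?_
        have hs : 0 < sin (2 * θ) :=
          sin_pos_of_pos_of_lt_pi (by linarith [hθ.1]) (by linarith [hθ.2])
        by_cases hmem : √(m + 1) * cos (2 * θ) ∈ A
        · rw [Set.indicator_of_mem hmem, Set.indicator_of_mem hmem, Pi.one_apply, mul_one,
            gaussianPDF, ← ENNReal.ofReal_mul (abs_nonneg _), ← ENNReal.ofReal_mul]
          · refine ENNReal.ofReal_le_ofReal ((sin_pow_le_gaussianPDFReal hm hs).trans_eq ?_)
            rw [show √(m + 1) * (-sin (2 * θ) * (2 * 1)) = -(√(m + 1) * (2 * sin (2 * θ))) by ring,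
              abs_neg, abs_of_pos (by positivity)]
          · have := (integral_sin_pow_pos (m - 1)).le
            positivity
        · simp [Set.indicator_of_notMem hmem]
    _ = ENNReal.ofReal ((1 + √(3 / m)) * ((∫ x in 0..π, sin x ^ (m - 1)) / 2)) *
        ∫⁻ w in (fun θ => √(m + 1) * cos (2 * θ)) '' Set.Ioo 0 (π / 2),
          A.indicator (gaussianPDF 0 1) w := by
      rw [lintegral_image_eq_lintegral_abs_deriv_mul measurableSet_Ioo hderiv hinj,
        lintegral_const_mul' _ _ ENNReal.ofReal_ne_top]
    _ ≤ _ := by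
      gcongr
      exact Measure.restrict_le_self

/-- Restricting the coordinates of a vector to those satisfying `p` and to the others. -/
def splitCoords {ι : Type*} (p : ι → Prop) (x : EuclideanSpace ℝ ι) :
    EuclideanSpace ℝ {i // p i} × EuclideanSpace ℝ {i // ¬p i} :=
  (WithLp.toLp 2 fun i => x i, WithLp.toLp 2 fun i => x i)

theorem measurePreserving_splitCoords {ι : Type*} [Fintype ι] (p : ι → Prop) [DecidablePred p] :
    MeasurePreserving (splitCoords p) :=
  ((PiLp.volume_preserving_toLp _).prod (PiLp.volume_preserving_toLp _)).comp
    ((volume_preserving_piEquivPiSubtypeProd (fun _ : ι => ℝ) p).comp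
      (PiLp.volume_preserving_ofLp ι))

theorem norm_splitCoords_fst_sq {ι : Type*} [Fintype ι] (p : ι → Prop) [DecidablePred p]
    (x : EuclideanSpace ℝ ι) : ‖(splitCoords p x).1‖ ^ 2 = ∑ i with p i, x i ^ 2 := by
  rw [EuclideanSpace.real_norm_sq_eq, sum_subtype (p := p) (univ.filter p) (by simp)]
  rfl

theorem norm_splitCoords_snd_sq {ι : Type*} [Fintype ι] (p : ι → Prop) [DecidablePred p]
    (x : EuclideanSpace ℝ ι) : ‖(splitCoords p x).2‖ ^ 2 = ∑ i with ¬p i, x i ^ 2 := by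
  rw [EuclideanSpace.real_norm_sq_eq, sum_subtype (p := fun i => ¬p i) _ (by simp)]
  rfl

theorem norm_sq_eq_norm_splitCoords {ι : Type*} [Fintype ι] (p : ι → Prop) [DecidablePred p]
    (x : EuclideanSpace ℝ ι) :
    ‖x‖ ^ 2 = ‖(splitCoords p x).1‖ ^ 2 + ‖(splitCoords p x).2‖ ^ 2 := by
  rw [norm_splitCoords_fst_sq, norm_splitCoords_snd_sq, EuclideanSpace.real_norm_sq_eq,
    sum_filter_add_sum_filter_not]

/-- The difference of the squared norms of two complementary blocks of coordinates of `x`,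
relative to the squared norm of `x`. -/
def blockRatio {ι : Type*} [Fintype ι] (p : ι → Prop) [DecidablePred p]
    (x : EuclideanSpace ℝ ι) : ℝ :=
  (∑ i with p i, x i ^ 2 - ∑ i with ¬p i, x i ^ 2) / ‖x‖ ^ 2

theorem measurable_blockRatio {ι : Type*} [Fintype ι] (p : ι → Prop) [DecidablePred p] :
    Measurable (blockRatio p) := by
  unfold blockRatio
  fun_prop

theorem blockRatio_smul {ι : Type*} [Fintype ι] (p : ι → Prop) [DecidablePred p]
    {c : ℝ} (hc : c ≠ 0) (x : EuclideanSpace ℝ ι) : blockRatio p (c • x) = blockRatio p x := by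
  have hc2 : c ^ 2 ≠ 0 := pow_ne_zero 2 hc
  simp only [blockRatio, PiLp.smul_apply, smul_eq_mul, mul_pow, ← mul_sum, ← mul_sub, norm_smul,
    norm_eq_abs, sq_abs]
  exact mul_div_mul_left _ _ hc2

theorem exists_volume_ball_inter_blockRatio {ι : Type*} [Fintype ι] (p : ι → Prop)
    [DecidablePred p] {m : ℕ} (hm : 0 < m) (hp : Fintype.card {i // p i} = m)
    (hp' : Fintype.card {i // ¬p i} = m) :
    ∃ κ : ENNReal, ∀ B : Set ℝ, MeasurableSet B →
      volume (Metric.ball 0 1 ∩ blockRatio p ⁻¹' B) =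
        κ * ∫⁻ θ in Set.Ioo 0 (π / 2),
          ENNReal.ofReal (sin (2 * θ) ^ (m - 1)) * B.indicator 1 (cos (2 * θ)) := by
  have : Nonempty {i // p i} := Fintype.card_pos_iff.1 (hp ▸ hm)
  have : Nonempty {i // ¬p i} := Fintype.card_pos_iff.1 (hp' ▸ hm)
  refine ⟨(volume : Measure (EuclideanSpace ℝ {i // p i})).toSphere Set.univ *
    (volume : Measure (EuclideanSpace ℝ {i // ¬p i})).toSphere Set.univ *
    ∫⁻ ρ in Set.Ioo (0 : ℝ) 1, ENNReal.ofReal (ρ ^ (2 * (m - 1) + 1) / 2 ^ (m - 1)),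
    fun B hB => ?_⟩
  have hH : Measurable (B.indicator (1 : ℝ → ENNReal)) := measurable_one.indicator hB
  have hG : Measurable (Function.uncurry fun r s : ℝ => if r ^ 2 + s ^ 2 < 1 then
      B.indicator (1 : ℝ → ENNReal) ((r ^ 2 - s ^ 2) / (r ^ 2 + s ^ 2)) else 0) := by
    refine Measurable.ite (measurableSet_lt (by fun_prop) (by fun_prop)) ?_ measurable_const
    exact hH.comp (by fun_prop)
  have hnorm := hG.comp
    (by fun_prop : Measurable fun y : EuclideanSpace ℝ {i // p i} × EuclideanSpace ℝ {i // ¬p i} =>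
      (‖y.1‖, ‖y.2‖))
  rw [mul_assoc, ← lintegral_quadrant_polar (m - 1) hH,
    ← lintegral_indicator_one (measurableSet_ball.inter (measurable_blockRatio p hB))]
  have hprod := lintegral_prod_fun_norm_addHaar
    (volume : Measure (EuclideanSpace ℝ {i // p i}))
    (volume : Measure (EuclideanSpace ℝ {i // ¬p i})) hG
  rw [finrank_euclideanSpace, finrank_euclideanSpace, hp, hp'] at hprod
  rw [← hprod, ← Measure.volume_eq_prod]
  refine (lintegral_congr fun x => ?_).trans
    ((measurePreserving_splitCoords p).lintegral_comp hnorm)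
  have hball : x ∈ Metric.ball (0 : EuclideanSpace ℝ ι) 1 ↔
      ‖(splitCoords p x).1‖ ^ 2 + ‖(splitCoords p x).2‖ ^ 2 < 1 := by
    rw [mem_ball_zero_iff, ← sq_lt_one_iff₀ (norm_nonneg x), norm_sq_eq_norm_splitCoords p]
  have hratio : blockRatio p x = (‖(splitCoords p x).1‖ ^ 2 - ‖(splitCoords p x).2‖ ^ 2) /
      (‖(splitCoords p x).1‖ ^ 2 + ‖(splitCoords p x).2‖ ^ 2) := by
    rw [blockRatio, norm_sq_eq_norm_splitCoords p, norm_splitCoords_fst_sq,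
      norm_splitCoords_snd_sq]
  simp only [← hratio]
  by_cases h : x ∈ Metric.ball (0 : EuclideanSpace ℝ ι) 1
  · rw [if_pos (hball.1 h)]
    exact Set.indicator_eq_indicator (by simp only [Set.mem_inter_iff, h, true_and]; rfl) rfl
  · rw [if_neg (mt hball.2 h), Set.indicator_of_notMem fun hx => h hx.1]

open scoped Pointwise in
theorem sphereUniform_blockRatio_le {ι : Type*} [Fintype ι] (p : ι → Prop)
    [DecidablePred p] {m : ℕ} (hm : 4 ≤ m) (hp : Fintype.card {i // p i} = m)
    (hp' : Fintype.card {i // ¬p i} = m) {A : Set ℝ} (hA : MeasurableSet A) :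
    sphereUniform ι {x | √(m + 1) * blockRatio p x ∈ A} ≤
      ENNReal.ofReal (1 + √(3 / m)) * gaussianReal 0 1 A := by
  have : Nonempty {i // p i} := Fintype.card_pos_iff.1 (by omega)
  have : Nonempty ι := .map Subtype.val this
  obtain ⟨κ, hκ⟩ := exists_volume_ball_inter_blockRatio p (by omega : 0 < m) hp hp'
  set B : Set ℝ := {t | √(m + 1) * t ∈ A}
  have hB : MeasurableSet B := hA.preimage (by fun_prop : Measurable fun t => √(m + 1 : ℝ) * t)
  have hcone : volume (Metric.ball (0 : EuclideanSpace ℝ ι) 1 ∩ blockRatio p ⁻¹' B) ≤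
      ENNReal.ofReal (1 + √(3 / m)) * gaussianReal 0 1 A *
        volume (Metric.ball (0 : EuclideanSpace ℝ ι) 1) := by
    have huniv := hκ Set.univ .univ
    simp only [Set.preimage_univ, Set.inter_univ, Set.indicator_univ, Pi.one_apply, mul_one]
      at huniv
    rw [hκ B hB, huniv, mul_left_comm]
    gcongr
    exact setLIntegral_sin_pow_le_gaussianReal hm hA
  have hsub : Set.Ioo (0 : ℝ) 1 • ((↑) '' {x : Metric.sphere (0 : EuclideanSpace ℝ ι) 1 |
      √(m + 1) * blockRatio p x ∈ A}) ⊆ Metric.ball 0 1 ∩ blockRatio p ⁻¹' B := by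
    rintro _ ⟨c, hc, _, ⟨x, hx, rfl⟩, rfl⟩
    refine ⟨?_, ?_⟩
    · simpa [norm_smul, abs_of_pos hc.1] using hc.2
    · simpa [B, blockRatio_smul p hc.1.ne'] using hx
  have hmeas : MeasurableSet {x : Metric.sphere (0 : EuclideanSpace ℝ ι) 1 |
      √(m + 1) * blockRatio p x ∈ A} :=
    hA.preimage (((measurable_blockRatio p).comp measurable_subtype_coe).const_mul _)
  rw [sphereUniform, Measure.smul_apply, smul_eq_mul, mul_comm, ← div_eq_mul_inv]
  refine ENNReal.div_le_of_le_mul ?_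
  rw [Measure.toSphere_apply' _ hmeas, Measure.toSphere_apply_univ, mul_left_comm]
  gcongr
  exact (measure_mono hsub).trans hcone

instance isProbabilityMeasure_sphereUniform {ι : Type*} [Fintype ι] [Nonempty ι] :
    IsProbabilityMeasure (sphereUniform ι) := by
  constructor
  rw [sphereUniform, Measure.smul_apply, smul_eq_mul]
  exact ENNReal.inv_mul_cancel (Measure.measure_univ_ne_zero.2 (Measure.toSphere_ne_zero _))
    (measure_ne_top _ _)

theorem stmt1 (n : ℕ) (hn : 2 ≤ n) (heven : Even n)
    (f : EuclideanSpace ℝ (Fin n) → ℝ)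
    (hf : ∀ x, f x = Real.sqrt ((n + 2) / 2) *
        ((∑ i ∈ Finset.univ.filter (fun i : Fin n => (i : ℕ) < n / 2), (x i) ^ 2) -
          ∑ i ∈ Finset.univ.filter (fun i : Fin n => n / 2 ≤ (i : ℕ)), (x i) ^ 2)) :
    dTV (MeasureTheory.Measure.map (fun x : Metric.sphere (0 : EuclideanSpace ℝ (Fin n)) 1 =>
            f x) (sphereUniform (Fin n)))
        (gaussianReal 0 1)
      ≤ Real.sqrt (6 / n) := by
  obtain ⟨m, hm⟩ := heven
  have hnm : (n : ℝ) = 2 * m := by rw [hm]; push_cast; ring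
  have : Nonempty (Fin n) := ⟨⟨0, by omega⟩⟩
  set p : Fin n → Prop := fun i => (i : ℕ) < n / 2 with hp_def
  have hfp (x : Metric.sphere (0 : EuclideanSpace ℝ (Fin n)) 1) :
      f x = √(m + 1) * blockRatio p x := by
    have hx : ‖(x : EuclideanSpace ℝ (Fin n))‖ = 1 := by simp
    rw [hf, blockRatio, hx, one_pow, div_one, hnm,
      show (2 * m + 2 : ℝ) / 2 = m + 1 by ring]
    simp only [hp_def, not_lt]
  have hmeas : Measurable fun x : Metric.sphere (0 : EuclideanSpace ℝ (Fin n)) 1 => f x := by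
    simp_rw [hfp]
    exact ((measurable_blockRatio p).comp measurable_subtype_coe).const_mul _
  have := Measure.isProbabilityMeasure_map (μ := sphereUniform (Fin n)) hmeas.aemeasurable
  have hrhs : (6 / n : ℝ) = 3 / m := by
    rw [hnm, show (6 : ℝ) = 2 * 3 by norm_num, mul_div_mul_left _ _ two_ne_zero]
  rw [hrhs]
  rcases lt_or_ge m 4 with hm4 | hm4
  · refine (dTV_le_one _ _).trans (one_le_sqrt.2 ?_)
    have hm0 : (0 : ℝ) < m := by exact_mod_cast (by omega : 0 < m)
    rw [one_le_div hm0]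
    exact_mod_cast (by omega : m ≤ 3)
  · have hp : Fintype.card {i // p i} = m := by
      rw [Fintype.card_subtype, Fin.card_filter_val_lt]
      omega
    have hp' : Fintype.card {i // ¬p i} = m := by
      rw [Fintype.card_subtype_compl, hp, Fintype.card_fin]
      omega
    refine dTV_le_of_le_mul (sqrt_nonneg _) fun A hA => ?_
    rw [Measure.map_apply hmeas hA]
    convert sphereUniform_blockRatio_le p hm4 hp hp' hA using 2
    ext x
    simp [hfp]

end
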